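/- For any ε > 0, 0 ≤ r < s ≤ 1, and function g : ℕ → [0,∞) with g(n) → 0 as n → ∞, there exists N (depending only on (s−r)ε and g) such that: whenever Q ⊆ [0,1]^X is a class of functions satisfying r_Q(n)/n ≤ g(n) for all n, and μ is a finitely-supported probability measure on X, there is an ε-net A for the fuzzy set system Q_{r,s} with respect to μ with |A| ≤ N. -/

import Mathlib

universe u

/-- The Rademacher mean width of a set `A ⊆ ℝⁿ`:
`w_R(A) = E_σ[sup_{a ∈ A} σ·a]` where `σ` is uniform on `{-1,+1}ⁿ`. -/
noncomputable def radWidth {n : ℕ} (A : Set (Fin n → ℝ)) : ℝ :=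
  (∑ σ : Fin n → Bool, ⨆ a ∈ A, ∑ i, (if σ i then (1 : ℝ) else -1) * a i) / 2 ^ n

/-- `r_Q(n) = sup_{x̄ ∈ Xⁿ} w_R(Q(x̄))` where `Q(x̄) = {(q(x₁),…,q(xₙ)) : q ∈ Q}`. -/
noncomputable def radMeanWidth {X : Type u} (Q : Set (X → ℝ)) (n : ℕ) : ℝ :=
  ⨆ xs : Fin n → X, radWidth ((fun q (i : Fin n) => q (xs i)) '' Q)

/-- The sign `±1` attached to a Boolean. -/
def boolSign (b : Bool) : ℝ := if b then 1 else -1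

theorem le_iSup_of_finite {ι : Type*} [Finite ι] (f : ι → ℝ) (j : ι) : f j ≤ ⨆ k, f k :=
  le_ciSup (Set.finite_range f).bddAbove j

theorem iSup_add_iSup_sub_le_of_lipschitz {ι : Type*} [Finite ι] [Nonempty ι] {φ : ℝ → ℝ}
    (hφ : ∀ s t, |φ s - φ t| ≤ |s - t|) (f h : ι → ℝ) :
    (⨆ j, (f j + φ (h j))) + (⨆ j, (f j - φ (h j))) ≤ (⨆ j, (f j + h j)) + ⨆ j, (f j - h j) := by
  obtain ⟨j, hj⟩ := exists_eq_ciSup_of_finite (f := fun j => f j + φ (h j))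
  obtain ⟨k, hk⟩ := exists_eq_ciSup_of_finite (f := fun j => f j - φ (h j))
  rw [← hj, ← hk]
  have h1 := le_iSup_of_finite (fun j => f j + h j) j
  have h2 := le_iSup_of_finite (fun j => f j + h j) k
  have h3 := le_iSup_of_finite (fun j => f j - h j) j
  have h4 := le_iSup_of_finite (fun j => f j - h j) k
  have h5 := (le_abs_self _).trans (hφ (h j) (h k))
  rcases abs_cases (h j - h k) with ⟨h6, -⟩ | ⟨h6, -⟩ <;> linarith

theorem sum_boolSign_cons {n : ℕ} (F : (Fin (n + 1) → Bool) → ℝ) :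
    ∑ σ, F σ = ∑ σ : Fin n → Bool, (F (Fin.cons true σ) + F (Fin.cons false σ)) := by
  rw [← (Fin.consEquiv fun _ => Bool).sum_comp, Fintype.sum_prod_type, Fintype.sum_bool,
    ← Finset.sum_add_distrib]
  rfl

/-- The Ledoux–Talagrand contraction principle for a finite family of vectors. -/
theorem sum_iSup_boolSign_comp_le {ι : Type*} [Finite ι] [Nonempty ι] {φ : ℝ → ℝ}
    (hφ : ∀ s t, |φ s - φ t| ≤ |s - t|) {n : ℕ} (a : ι → Fin n → ℝ) (f : ι → ℝ) :
    ∑ σ : Fin n → Bool, ⨆ j, (f j + ∑ i, boolSign (σ i) * φ (a j i)) ≤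
      ∑ σ : Fin n → Bool, ⨆ j, (f j + ∑ i, boolSign (σ i) * a j i) := by
  induction n generalizing f with
  | zero => simp
  | succ n ih =>
    rw [sum_boolSign_cons, sum_boolSign_cons]
    simp only [Fin.sum_univ_succ, Fin.cons_zero, Fin.cons_succ]
    rw [Finset.sum_add_distrib]
    have h1 := ih (fun j i => a j i.succ) (fun j => f j + boolSign true * φ (a j 0))
    have h2 := ih (fun j i => a j i.succ) (fun j => f j + boolSign false * φ (a j 0))
    simp only [add_assoc] at h1 h2
    refine (add_le_add h1 h2).trans ?_
    rw [← Finset.sum_add_distrib]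
    refine Finset.sum_le_sum fun σ _ => ?_
    have h := iSup_add_iSup_sub_le_of_lipschitz hφ
      (fun j => f j + ∑ i : Fin n, boolSign (σ i) * a j i.succ) (fun j => a j 0)
    simpa [boolSign, add_assoc, add_comm, add_left_comm, sub_eq_add_neg] using h

theorem sum_pi_prod_mul_apply {S : Type*} [Fintype S] {n : ℕ} (p u : S → ℝ) (hp : ∑ x, p x = 1)
    (i : Fin n) : ∑ y : Fin n → S, (∏ j, p (y j)) * u (y i) = ∑ x, p x * u x := by
  have h (y : Fin n → S) : (∏ j, p (y j)) * u (y i) =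
      ∏ j, (p (y j) * if j = i then u (y j) else 1) := by
    rw [Finset.prod_mul_distrib]; simp
  simp_rw [h]
  rw [← Fintype.prod_sum (fun j x => p x * if j = i then u x else 1), Fintype.prod_eq_single i]
  · simp
  · intro j hj
    simpa [hj] using hp

theorem sum_pi_prod_eq_one {S : Type*} [Fintype S] (p : S → ℝ) (hp : ∑ x, p x = 1) (n : ℕ) :
    ∑ y : Fin n → S, ∏ j, p (y j) = 1 := by
  rw [← Fintype.prod_sum (fun (_ : Fin n) x => p x)]
  simp [hp]

/-- The symmetrization inequality for a finite family of functions on a finite probability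
space. -/
theorem sum_prod_mul_iSup_sub_le {S ι : Type*} [Fintype S] [Finite ι] [Nonempty ι] {n : ℕ}
    (p : S → ℝ) (hp0 : ∀ x, 0 ≤ p x) (hp : ∑ x, p x = 1) (v : ι → S → ℝ) (M : ℝ)
    (hM : ∀ x : Fin n → S,
      ∑ σ : Fin n → Bool, ⨆ j, ∑ i, boolSign (σ i) * v j (x i) ≤ 2 ^ n * M) :
    ∑ z : Fin n → S × S, (∏ i, p (z i).1 * p (z i).2) * ⨆ j, ∑ i, (v j (z i).1 - v j (z i).2) ≤
      2 * M := by
  have hM' (x : Fin n → S) :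
      ∑ σ : Fin n → Bool, ⨆ j, ∑ i, -(boolSign (σ i) * v j (x i)) ≤ 2 ^ n * M := by
    refine le_of_eq_of_le ?_ (hM x)
    rw [← ((Equiv.refl (Fin n)).arrowCongr Equiv.boolNot).sum_comp]
    refine Finset.sum_congr rfl fun σ _ => iSup_congr fun j => Finset.sum_congr rfl fun i _ => ?_
    cases h : σ i <;> simp [boolSign, h]
  have hflip (σ : Fin n → Bool) :
      ∑ z : Fin n → S × S, (∏ i, p (z i).1 * p (z i).2) * ⨆ j, ∑ i, (v j (z i).1 - v j (z i).2) =
      ∑ z : Fin n → S × S, (∏ i, p (z i).1 * p (z i).2) *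
        ⨆ j, ∑ i, boolSign (σ i) * (v j (z i).1 - v j (z i).2) := by
    rw [← (Equiv.piCongrRight fun i =>
      if σ i then Equiv.refl (S × S) else Equiv.prodComm S S).sum_comp]
    refine Finset.sum_congr rfl fun z _ => ?_
    congr 1
    · refine Finset.prod_congr rfl fun i _ => ?_
      cases h : σ i <;> simp [h, mul_comm]
    · refine iSup_congr fun j => Finset.sum_congr rfl fun i _ => ?_
      cases h : σ i <;> simp [boolSign, h]
  have hsum : ∑ z : Fin n → S × S, ∏ i, p (z i).1 * p (z i).2 = 1 :=
    sum_pi_prod_eq_one (fun z : S × S => p z.1 * p z.2)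
      (by rw [Fintype.sum_prod_type, ← Fintype.sum_mul_sum, hp, one_mul]) n
  have hpow : (0 : ℝ) < 2 ^ n := by positivity
  refine le_of_mul_le_mul_left ?_ hpow
  calc
    _ = ∑ σ : Fin n → Bool, ∑ z : Fin n → S × S, (∏ i, p (z i).1 * p (z i).2) *
        ⨆ j, ∑ i, boolSign (σ i) * (v j (z i).1 - v j (z i).2) := by
      rw [← Finset.sum_congr rfl fun σ _ => hflip σ]
      simp
    _ = ∑ z : Fin n → S × S, (∏ i, p (z i).1 * p (z i).2) *
        ∑ σ : Fin n → Bool, ⨆ j, ∑ i, boolSign (σ i) * (v j (z i).1 - v j (z i).2) := by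
      rw [Finset.sum_comm]
      simp_rw [Finset.mul_sum]
    _ ≤ ∑ z : Fin n → S × S, (∏ i, p (z i).1 * p (z i).2) * (2 ^ n * (2 * M)) := by
      refine Finset.sum_le_sum fun z _ => mul_le_mul_of_nonneg_left ?_
        (Finset.prod_nonneg fun i _ => mul_nonneg (hp0 _) (hp0 _))
      have h1 := hM fun i => (z i).1
      have h2 := hM' fun i => (z i).2
      have h3 : ∑ σ : Fin n → Bool, ⨆ j, ∑ i, boolSign (σ i) * (v j (z i).1 - v j (z i).2) ≤
          (∑ σ : Fin n → Bool, ⨆ j, ∑ i, boolSign (σ i) * v j (z i).1) +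
          ∑ σ : Fin n → Bool, ⨆ j, ∑ i, -(boolSign (σ i) * v j (z i).2) := by
        rw [← Finset.sum_add_distrib]
        refine Finset.sum_le_sum fun σ _ => ciSup_le fun j => ?_
        refine le_of_eq_of_le ?_ (add_le_add
          (le_iSup_of_finite (fun j => ∑ i, boolSign (σ i) * v j (z i).1) j)
          (le_iSup_of_finite (fun j => ∑ i, -(boolSign (σ i) * v j (z i).2)) j))
        rw [← Finset.sum_add_distrib]
        exact Finset.sum_congr rfl fun i _ => by ring
      linarith
    _ = _ := by rw [← Finset.sum_mul, hsum, one_mul]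

/-- If every sample `x` is matched with some `v (j x)` whose values on the sample exceed its mean
by at least `e`, then the expected one-sided deviation is at least `n * e`. -/
theorem le_sum_prod_mul_iSup_sub {S ι : Type*} [Fintype S] [Finite ι] {n : ℕ}
    (p : S → ℝ) (hp0 : ∀ x, 0 ≤ p x) (hp : ∑ x, p x = 1) (v : ι → S → ℝ) (e : ℝ)
    (j : (Fin n → S) → ι)
    (hj : ∀ x i, e ≤ ∑ y, p y * (v (j x) (x i) - v (j x) y)) :
    n * e ≤ ∑ z : Fin n → S × S, (∏ i, p (z i).1 * p (z i).2) *
      ⨆ j, ∑ i, (v j (z i).1 - v j (z i).2) := by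
  calc
    n * e = ∑ x : Fin n → S, (∏ i, p (x i)) * (n * e) := by
      rw [← Finset.sum_mul, sum_pi_prod_eq_one p hp, one_mul]
    _ ≤ ∑ x : Fin n → S, (∏ i, p (x i)) *
        ∑ i, ∑ y : Fin n → S, (∏ i, p (y i)) * (v (j x) (x i) - v (j x) (y i)) := by
      refine Finset.sum_le_sum fun x _ => mul_le_mul_of_nonneg_left ?_
        (Finset.prod_nonneg fun i _ => hp0 _)
      have h (i : Fin n) : e ≤
          ∑ y : Fin n → S, (∏ i, p (y i)) * (v (j x) (x i) - v (j x) (y i)) := by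
        rw [sum_pi_prod_mul_apply p (fun y => v (j x) (x i) - v (j x) y) hp i]
        exact hj x i
      simpa using Finset.sum_le_sum fun i (_ : i ∈ Finset.univ) => h i
    _ = ∑ z : Fin n → S × S, (∏ i, p (z i).1 * p (z i).2) *
        ∑ i, (v (j fun i => (z i).1) (z i).1 - v (j fun i => (z i).1) (z i).2) := by
      rw [← (Equiv.arrowProdEquivProdArrow (Fin n) (fun _ => S) (fun _ => S)).symm.sum_comp,
        Fintype.sum_prod_type]
      refine Finset.sum_congr rfl fun x _ => ?_
      rw [Finset.sum_comm, Finset.mul_sum]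
      refine Finset.sum_congr rfl fun y _ => ?_
      rw [← Finset.mul_sum, ← mul_assoc, ← Finset.prod_mul_distrib]
      rfl
    _ ≤ _ := Finset.sum_le_sum fun z _ => mul_le_mul_of_nonneg_left
        (le_iSup_of_finite (fun j => ∑ i, (v j (z i).1 - v j (z i).2)) (j fun i => (z i).1))
        (Finset.prod_nonneg fun i _ => mul_nonneg (hp0 _) (hp0 _))

theorem sum_boolSign_mul_le {n : ℕ} (σ : Fin n → Bool) {a : Fin n → ℝ}
    (ha : ∀ i, a i ∈ Set.Icc (0 : ℝ) 1) : ∑ i, boolSign (σ i) * a i ≤ n := by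
  have h (i : Fin n) : boolSign (σ i) * a i ≤ 1 := by
    have := ha i
    cases σ i <;> simp [boolSign] <;> linarith [this.1, this.2]
  simpa using Finset.sum_le_sum fun i (_ : i ∈ Finset.univ) => h i

theorem biSup_sum_boolSign_mul_le {n : ℕ} {A : Set (Fin n → ℝ)}
    (hA : ∀ a ∈ A, ∀ i, a i ∈ Set.Icc (0 : ℝ) 1) (σ : Fin n → Bool) (a : Fin n → ℝ) :
    ⨆ _ : a ∈ A, ∑ i, boolSign (σ i) * a i ≤ n :=
  Real.iSup_le (fun h => sum_boolSign_mul_le σ (hA a h)) n.cast_nonneg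

theorem radWidth_le {n : ℕ} {A : Set (Fin n → ℝ)} (hA : ∀ a ∈ A, ∀ i, a i ∈ Set.Icc (0 : ℝ) 1) :
    radWidth A ≤ n := by
  unfold radWidth
  rw [div_le_iff₀ (by positivity)]
  have h (σ : Fin n → Bool) : ⨆ a ∈ A, ∑ i, boolSign (σ i) * a i ≤ n :=
    Real.iSup_le (biSup_sum_boolSign_mul_le hA σ) n.cast_nonneg
  refine (Finset.sum_le_sum fun σ _ => h σ).trans ?_
  simp [mul_comm]

theorem sum_iSup_boolSign_le_radWidth {n : ℕ} {A : Set (Fin n → ℝ)}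
    (hA : ∀ a ∈ A, ∀ i, a i ∈ Set.Icc (0 : ℝ) 1) {ι : Type*} [Nonempty ι]
    (a : ι → Fin n → ℝ) (ha : ∀ j, a j ∈ A) :
    ∑ σ : Fin n → Bool, ⨆ j, ∑ i, boolSign (σ i) * a j i ≤ 2 ^ n * radWidth A := by
  unfold radWidth
  rw [mul_div_cancel₀ _ (by positivity)]
  refine Finset.sum_le_sum fun σ _ => ciSup_le fun j => ?_
  have h := le_ciSup (f := fun b => ⨆ _ : b ∈ A, ∑ i, boolSign (σ i) * b i)
    ⟨n, Set.forall_mem_range.2 (biSup_sum_boolSign_mul_le hA σ)⟩ (a j)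
  simp only [ciSup_pos (ha j)] at h
  exact h

theorem radWidth_le_radMeanWidth {X : Type u} {Q : Set (X → ℝ)}
    (hQ : ∀ q ∈ Q, ∀ x, q x ∈ Set.Icc (0 : ℝ) 1) {n : ℕ} (xs : Fin n → X) :
    radWidth ((fun q (i : Fin n) => q (xs i)) '' Q) ≤ radMeanWidth Q n := by
  have hbdd (ys : Fin n → X) : radWidth ((fun q (i : Fin n) => q (ys i)) '' Q) ≤ n := by
    refine radWidth_le ?_
    rintro _ ⟨q, hq, rfl⟩ i
    exact hQ q hq _
  exact le_ciSup ⟨(n : ℝ), Set.forall_mem_range.2 hbdd⟩ xs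

theorem abs_clamp_sub_clamp_le (r s t u : ℝ) :
    |max r (min t s) - max r (min u s)| ≤ |t - u| := by
  rw [max_comm r, max_comm r]
  exact (abs_max_sub_max_le_abs _ _ _).trans (by simpa using abs_min_sub_min_le_max t s u s)

/-- For every `e = (s-r)ε > 0` and `g : ℕ → [0,∞)` with `g(n) → 0`, there is
`N = N((s-r)ε, g)` such that: for any class `Q ⊆ [0,1]^X` with `r_Q(n)/n ≤ g(n)`
for all `n`, and any finitely-supported probability measure on `X` (given by its
weight function `w`), there is an `ε`-net `A` for the fuzzy set system `Q_{r,s}`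
with respect to the measure, with `|A| ≤ N`. -/
theorem stmt_2 (e : ℝ) (he : 0 < e) (g : ℕ → ℝ) (hg0 : ∀ n, 0 ≤ g n)
    (hg : Filter.Tendsto g Filter.atTop (nhds 0)) :
    ∃ N : ℕ, ∀ (X : Type u) (Q : Set (X → ℝ)),
      (∀ q ∈ Q, ∀ x, q x ∈ Set.Icc (0 : ℝ) 1) →
      ∀ r s ε : ℝ, 0 ≤ r → r < s → s ≤ 1 → 0 < ε → (s - r) * ε = e →
      (∀ n : ℕ, radMeanWidth Q n / (n : ℝ) ≤ g n) →
      ∀ w : X → ℝ, (Function.support w).Finite → (∀ x, 0 ≤ w x) →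
        (∑ᶠ x, w x) = 1 →
      ∃ A : Finset X, A.card ≤ N ∧
        ∀ q ∈ Q, ε ≤ (∑ᶠ x ∈ {y | q y ≤ r}, w x) → ∃ a ∈ A, q a < s := by
  obtain ⟨n, hgn, hn⟩ := ((hg.eventually_lt_const (half_pos he)).and
    (Filter.eventually_gt_atTop 0)).exists
  refine ⟨n, fun X Q hQ r s ε hr hrs hs hε hsre hQg w hfin hw0 hw1 => ?_⟩
  classical
  by_contra! hcon
  have hn' : (0 : ℝ) < n := by exact_mod_cast hn
  have hbad (x : Fin n → hfin.toFinset) : ∃ q ∈ Q, (ε ≤ ∑ᶠ x ∈ {y | q y ≤ r}, w x) ∧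
      ∀ i, s ≤ q (x i) := by
    obtain ⟨q, hq, hε, h⟩ := hcon (Finset.univ.image fun i => (x i : X))
      (Finset.card_image_le.trans (by simp))
    exact ⟨q, hq, hε, fun i => h _ (by simp)⟩
  choose q hqQ hqε hqs using hbad
  have hp : ∑ x : hfin.toFinset, w x = 1 := by
    rw [Finset.sum_coe_sort, ← finsum_eq_sum w hfin, hw1]
  have : Nonempty hfin.toFinset := by
    by_contra h
    rw [not_nonempty_iff] at h
    simp at hp
  have hmass (x : Fin n → hfin.toFinset) :
      ∑ᶠ y ∈ {y | q x y ≤ r}, w y = ∑ y : hfin.toFinset, if q x y ≤ r then w y else 0 := by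
    rw [Finset.sum_coe_sort hfin.toFinset fun y => if q x y ≤ r then w y else 0, finsum_mem_def,
      finsum_eq_sum_of_support_subset (s := hfin.toFinset)]
    · exact Finset.sum_congr rfl fun y _ => by simp [Set.indicator_apply]
    · simp
  have hub := sum_prod_mul_iSup_sub_le (n := n) (fun x : hfin.toFinset => w x) (fun x => hw0 x) hp
    (fun x y => max r (min (q x y) s)) (radMeanWidth Q n) fun x => by
      have h := sum_iSup_boolSign_comp_le (abs_clamp_sub_clamp_le r s)
        (fun j i => q j (x i)) (fun _ => 0)
      simp only [zero_add] at h
      have hA : ∀ a ∈ (fun q (i : Fin n) => q (x i : X)) '' Q, ∀ i, a i ∈ Set.Icc (0 : ℝ) 1 := by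
        rintro _ ⟨q, hq, rfl⟩ i
        exact hQ q hq _
      have h' := sum_iSup_boolSign_le_radWidth hA (fun j i => q j (x i))
        fun j => ⟨q j, hqQ j, rfl⟩
      exact h.trans (h'.trans (mul_le_mul_of_nonneg_left
        (radWidth_le_radMeanWidth hQ fun i => (x i : X)) (by positivity)))
  have hlb := le_sum_prod_mul_iSup_sub (n := n) (fun x : hfin.toFinset => w x) (fun x => hw0 x) hp
    (fun x y => max r (min (q x y) s)) e id fun x i => by
      rw [← hsre]
      refine (mul_le_mul_of_nonneg_left ((hqε x).trans_eq (hmass x)) (sub_pos.2 hrs).le).trans ?_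
      rw [Finset.mul_sum]
      refine Finset.sum_le_sum fun y _ => ?_
      simp only [id, min_eq_right (hqs x i), max_eq_right hrs.le]
      split_ifs with h
      · rw [min_eq_left (h.trans hrs.le), max_eq_left h, mul_comm]
      · rw [mul_zero]
        exact mul_nonneg (hw0 y) (sub_nonneg.2 (max_le hrs.le (min_le_right _ _)))
  have hR := (div_le_iff₀ hn').1 (hQg n)
  linarith [hlb.trans hub, mul_lt_mul_of_pos_right hgn hn']
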